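/- arXiv:1605.06631 — 2 statements merged into one kernel-verified Lean document; each statement's English description precedes it below -/
import Mathlib

section
/- For |q|<1, φ(q)·φ(q⁷) = 1 + 2·∑_{j≥1} χ₇(j)·( q^j/(1−q^j) − 2q^{2j}/(1−q^{2j}) + 2q^{4j}/(1−q^{4j}) ), where χ₇ is the Legendre symbol mod 7. -/
noncomputable section

instance : Fact (Nat.Prime 7) := ⟨by norm_num⟩

/-- The norm form `a² + ab + 2b²` of the ring of integers of `ℚ(√-7)`. -/
def normForm (a b : ℤ) : ℤ := a ^ 2 + a * b + 2 * b ^ 2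

/-- The representations of `n` by `normForm`. -/
def normReps (n : ℕ) : Set (ℤ × ℤ) := {z | normForm z.1 z.2 = n}

/-- The representations of `n` by `x² + 7y²`. -/
def diagReps (n : ℕ) : Set (ℤ × ℤ) := {z | z.1 ^ 2 + 7 * z.2 ^ 2 = n}

/-- The divisor sum `∑_{d ∣ n} (d / 7)`. -/
def charSum (n : ℕ) : ℤ := ∑ d ∈ n.divisors, legendreSym 7 d

lemma finite_of_sq_le (S : Set (ℤ × ℤ)) (n : ℤ)
    (h : ∀ z ∈ S, z.1 ^ 2 ≤ n ∧ z.2 ^ 2 ≤ n) : S.Finite := by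
  refine ((Set.finite_Icc (-n) n).prod (Set.finite_Icc (-n) n)).subset fun z hz => ?_
  obtain ⟨h1, h2⟩ := h z hz
  simp only [Set.mem_prod, Set.mem_Icc]
  have h3 := Int.le_self_sq (-z.1)
  have h4 := Int.le_self_sq (-z.2)
  rw [neg_sq] at h3 h4
  exact ⟨⟨by linarith, by linarith [Int.le_self_sq z.1]⟩,
    by linarith, by linarith [Int.le_self_sq z.2]⟩

lemma normReps_finite (n : ℕ) : (normReps n).Finite := by
  refine finite_of_sq_le _ (2 * n) fun z hz => ?_
  simp only [normReps, normForm, Set.mem_ofPred_eq] at hz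
  constructor <;> nlinarith [sq_nonneg (2 * z.1 + z.2), sq_nonneg (z.1 + 2 * z.2),
    sq_nonneg z.1, sq_nonneg z.2, sq_nonneg (z.1 + z.2)]

/-- Multiplication by `u + vω` in the coordinates of the basis `1, ω` with `ω² = ω - 2`. -/
def mulBy (u v : ℤ) (z : ℤ × ℤ) : ℤ × ℤ := (u * z.1 - 2 * v * z.2, u * z.2 + v * z.1 + v * z.2)

lemma normForm_mulBy (u v : ℤ) (z : ℤ × ℤ) :
    normForm (mulBy u v z).1 (mulBy u v z).2 = normForm u v * normForm z.1 z.2 := by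
  simp only [mulBy, normForm]; ring

lemma mulBy_conj (u v : ℤ) (z : ℤ × ℤ) :
    mulBy (u + v) (-v) (mulBy u v z) = (normForm u v * z.1, normForm u v * z.2) := by
  simp only [mulBy, normForm]; ext <;> ring

lemma mulBy_conj' (u v : ℤ) (z : ℤ × ℤ) :
    mulBy u v (mulBy (u + v) (-v) z) = (normForm u v * z.1, normForm u v * z.2) := by
  simp only [mulBy, normForm]; ext <;> ring

lemma mulBy_smul (u v k : ℤ) (z : ℤ × ℤ) :
    mulBy u v (k * z.1, k * z.2) = (k * (mulBy u v z).1, k * (mulBy u v z).2) := by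
  simp only [mulBy]; ext <;> ring

lemma smul_injective {k : ℤ} (hk : k ≠ 0) :
    Function.Injective fun z : ℤ × ℤ => (k * z.1, k * z.2) := by
  intro x y h
  simp only [Prod.mk.injEq, mul_right_inj' hk] at h
  exact Prod.ext h.1 h.2

lemma mulBy_injective {u v : ℤ} (h : normForm u v ≠ 0) : Function.Injective (mulBy u v) := by
  intro x y hxy
  apply smul_injective h
  simp only [← mulBy_conj, hxy]

/-- Multiples of an element of prime norm are recognised by a linear congruence. -/
lemma image_mulBy {p : ℕ} (hp : p.Prime) {u v : ℤ} (huv : normForm u v = p) (n : ℕ) :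
    mulBy u v '' normReps n = {z ∈ normReps (p * n) | (p : ℤ) ∣ u * z.2 - v * z.1} := by
  have hp' : Prime (p : ℤ) := Nat.prime_iff_prime_int.mp hp
  ext z
  constructor
  · rintro ⟨w, hw, rfl⟩
    simp only [normReps, Set.mem_ofPred_eq, normForm_mulBy] at hw ⊢
    refine ⟨by rw [hw, huv]; push_cast; ring, ⟨w.2, ?_⟩⟩
    rw [← huv]; simp only [mulBy, normForm]; ring
  · rintro ⟨hz, hd⟩
    simp only [normReps, Set.mem_ofPred_eq] at hz
    set w := mulBy (u + v) (-v) z with hw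
    have h2 : (p : ℤ) ∣ w.2 := by convert hd using 1; simp only [hw, mulBy]; ring
    have hN : normForm w.1 w.2 = p * (p * n) := by
      rw [hw, normForm_mulBy, hz]
      have : normForm (u + v) (-v) = p := by rw [← huv]; simp only [normForm]; ring
      rw [this]; push_cast; ring
    have h1 : (p : ℤ) ∣ w.1 := by
      have : (p : ℤ) ∣ w.1 ^ 2 := by
        have e : w.1 ^ 2 = p * (p * n) - w.2 * (w.1 + 2 * w.2) := by
          rw [← hN]; simp only [normForm]; ring
        rw [e]
        exact dvd_sub (dvd_mul_right _ _) (h2.mul_right _)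
      exact hp'.dvd_of_dvd_pow this
    obtain ⟨c, hc⟩ := h1
    obtain ⟨d, hd⟩ := h2
    have hpw : w = ((p : ℤ) * c, (p : ℤ) * d) := Prod.ext hc hd
    refine ⟨(c, d), ?_, ?_⟩
    · simp only [normReps, Set.mem_ofPred_eq]
      have h0 : (p : ℤ) * p ≠ 0 := mul_ne_zero hp'.ne_zero hp'.ne_zero
      apply mul_left_cancel₀ h0
      rw [mul_assoc, mul_assoc, ← hN, hc, hd]; simp only [normForm]; ring
    · apply smul_injective hp'.ne_zero
      have := mulBy_smul u v p (c, d)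
      simp only at this ⊢
      rw [← this, ← hpw, hw, mulBy_conj', huv]

lemma normReps_dvd_card {p : ℕ} (hp : p.Prime) (n : ℕ) :
    {z ∈ normReps (p * n) | (p : ℤ) ∣ z.1 ∧ (p : ℤ) ∣ z.2}.ncard =
      if p ∣ n then (normReps (n / p)).ncard else 0 := by
  have hp0 : (p : ℤ) ≠ 0 := by exact_mod_cast hp.ne_zero
  split_ifs with h
  · obtain ⟨m, rfl⟩ := h
    rw [Nat.mul_div_cancel_left _ hp.pos, ← Set.ncard_image_of_injective (normReps m) (smul_injective hp0)]
    congr 1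
    ext ⟨a, b⟩
    simp only [normReps, Set.mem_ofPred_eq, Set.mem_image, Prod.exists, Prod.mk.injEq]
    constructor
    · rintro ⟨hN, ⟨c, rfl⟩, ⟨d, rfl⟩⟩
      refine ⟨c, d, ?_, rfl, rfl⟩
      apply mul_left_cancel₀ (mul_ne_zero hp0 hp0)
      push_cast at hN
      rw [mul_assoc, mul_assoc, ← hN]; simp only [normForm]; ring
    · rintro ⟨c, d, hN, rfl, rfl⟩
      refine ⟨?_, dvd_mul_right _ _, dvd_mul_right _ _⟩
      push_cast
      rw [← hN]; simp only [normForm]; ring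
  · rw [Set.ncard_eq_zero ((normReps_finite _).subset (Set.sep_subset _ _))]
    ext ⟨a, b⟩
    simp only [normReps, Set.mem_ofPred_eq, Set.mem_empty_iff_false, iff_false]
    rintro ⟨hN, ⟨c, rfl⟩, ⟨d, rfl⟩⟩
    apply h
    rw [← Int.natCast_dvd_natCast]
    refine ⟨normForm c d, ?_⟩
    apply mul_left_cancel₀ hp0
    push_cast at hN
    rw [← hN]; simp only [normForm]; ring

lemma ncard_normReps_split {p : ℕ} (hp : p.Prime) (hp7 : p ≠ 7) {u v : ℤ}
    (huv : normForm u v = p) (n : ℕ) :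
    ((normReps (p * n)).ncard : ℤ) = 2 * (normReps n).ncard -
      (if p ∣ n then (normReps (n / p)).ncard else 0 : ℕ) := by
  have hp' : Prime (p : ℤ) := Nat.prime_iff_prime_int.mp hp
  have huv' : normForm (u + v) (-v) = p := by rw [← huv]; simp only [normForm]; ring
  have hp0 := hp'.ne_zero
  have hv : ¬ (p : ℤ) ∣ v := by
    intro hv
    have hu : (p : ℤ) ∣ u := by
      have : (p : ℤ) ∣ u ^ 2 := by
        have e : u ^ 2 = p - v * (u + 2 * v) := by rw [← huv]; simp only [normForm]; ring
        rw [e]; exact dvd_sub dvd_rfl (hv.mul_right _)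
      exact hp'.dvd_of_dvd_pow this
    obtain ⟨c, rfl⟩ := hu
    obtain ⟨d, rfl⟩ := hv
    apply hp'.not_isUnit
    refine IsUnit.of_mul_eq_one (normForm c d) ?_
    apply mul_left_cancel₀ hp0
    rw [mul_one]
    conv_rhs => rw [← huv]
    simp only [normForm]; ring
  have h7 : ¬ (p : ℤ) ∣ 7 := by
    intro h
    have : p ∣ 7 := by exact_mod_cast h
    exact hp7 ((Nat.prime_dvd_prime_iff_eq hp (by norm_num)).mp this)
  have h2 : ¬ (p : ℤ) ∣ 2 * u + v := by
    intro h
    have : (p : ℤ) ∣ 7 * v ^ 2 := by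
      have e : 7 * v ^ 2 = p * 4 - (2 * u + v) * (2 * u + v) := by
        rw [← huv]; simp only [normForm]; ring
      rw [e]; exact dvd_sub (dvd_mul_right _ _) (h.mul_right _)
    rcases hp'.dvd_or_dvd this with h | h
    · exact h7 h
    · exact hv (hp'.dvd_of_dvd_pow h)
  have hunion : normReps (p * n) = mulBy u v '' normReps n ∪ mulBy (u + v) (-v) '' normReps n := by
    rw [image_mulBy hp huv, image_mulBy hp huv', ← Set.sep_or]
    ext z
    simp only [Set.mem_ofPred_eq, iff_self_and]
    intro hz
    apply hp'.dvd_or_dvd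
    simp only [normReps, Set.mem_ofPred_eq] at hz
    refine ⟨normForm z.1 z.2 * (-v ^ 2) / p + z.2 ^ 2, ?_⟩
    rw [hz]
    have : ((p * n : ℕ) : ℤ) * (-v ^ 2) / p = n * (-v ^ 2) := by
      push_cast; rw [mul_assoc, Int.mul_ediv_cancel_left _ hp0]
    rw [this, mul_add, ← mul_assoc]
    have : (p * n : ℤ) = normForm z.1 z.2 := by rw [hz]; push_cast; rfl
    rw [this, ← huv]; simp only [normForm]; ring
  have hinter : mulBy u v '' normReps n ∩ mulBy (u + v) (-v) '' normReps n =
      {z ∈ normReps (p * n) | (p : ℤ) ∣ z.1 ∧ (p : ℤ) ∣ z.2} := by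
    rw [image_mulBy hp huv, image_mulBy hp huv', ← Set.sep_and]
    ext z
    simp only [Set.mem_ofPred_eq, and_congr_right_iff]
    intro _
    constructor
    · rintro ⟨ha, hb⟩
      have hz2 : (p : ℤ) ∣ z.2 := by
        have : (p : ℤ) ∣ (2 * u + v) * z.2 := by
          have e : (2 * u + v) * z.2 = (u * z.2 - v * z.1) + ((u + v) * z.2 - -v * z.1) := by ring
          rw [e]; exact dvd_add ha hb
        exact (hp'.dvd_or_dvd this).resolve_left h2
      refine ⟨?_, hz2⟩
      have : (p : ℤ) ∣ v * z.1 := by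
        have e : v * z.1 = u * z.2 - (u * z.2 - v * z.1) := by ring
        rw [e]; exact dvd_sub (hz2.mul_left u) ha
      exact (hp'.dvd_or_dvd this).resolve_left hv
    · rintro ⟨h1, h2⟩
      exact ⟨dvd_sub (h2.mul_left _) (h1.mul_left _), dvd_sub (h2.mul_left _) (h1.mul_left _)⟩
  have := Set.ncard_union_add_ncard_inter (mulBy u v '' normReps n)
    (mulBy (u + v) (-v) '' normReps n) ((normReps_finite n).image _) ((normReps_finite n).image _)
  rw [← hunion, hinter, normReps_dvd_card hp,
    Set.ncard_image_of_injective _ (mulBy_injective (by rw [huv]; exact hp0)),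
    Set.ncard_image_of_injective _ (mulBy_injective (by rw [huv']; exact hp0))] at this
  lia

lemma ncard_normReps_seven (n : ℕ) : (normReps (7 * n)).ncard = (normReps n).ncard := by
  have h7 : Nat.Prime 7 := by norm_num
  have huv : normForm (-1) 2 = (7 : ℕ) := by norm_num [normForm]
  rw [← Set.ncard_image_of_injective (normReps n)
    (mulBy_injective (u := -1) (v := 2) (by rw [huv]; norm_num)), image_mulBy h7 huv]
  congr 1
  ext z
  simp only [Set.mem_ofPred_eq, iff_self_and]
  intro hz
  simp only [normReps, Set.mem_ofPred_eq, normForm] at hz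
  have hp' : Prime ((7 : ℕ) : ℤ) := Nat.prime_iff_prime_int.mp h7
  apply hp'.dvd_of_dvd_pow (n := 2)
  push_cast at hz ⊢
  exact ⟨4 * n - z.2 ^ 2, by linear_combination 4 * hz⟩

lemma legendreSym_neg_seven {p : ℕ} [Fact p.Prime] (hp2 : p ≠ 2) :
    legendreSym p (-7) = legendreSym 7 p := by
  have hodd : p % 4 = 1 ∨ p % 4 = 3 := by
    have := (Fact.out : p.Prime).eq_two_or_odd
    lia
  have : (-7 : ℤ) = -1 * ((7 : ℕ) : ℤ) := by norm_num
  rw [this, legendreSym.mul, legendreSym.at_neg_one hp2]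
  rcases hodd with h | h
  · rw [ZMod.χ₄_nat_one_mod_four h, one_mul, legendreSym.quadratic_reciprocity_one_mod_four h]
    norm_num
  · rw [ZMod.χ₄_nat_three_mod_four h,
      legendreSym.quadratic_reciprocity_three_mod_four (p := 7) (by norm_num) h]
    norm_num

lemma dvd_of_dvd_normForm {p : ℕ} (hp : p.Prime) (h : legendreSym 7 p = -1) {a b : ℤ}
    (hd : (p : ℤ) ∣ normForm a b) : (p : ℤ) ∣ a ∧ (p : ℤ) ∣ b := by
  have : Fact p.Prime := ⟨hp⟩
  have hp' : Prime (p : ℤ) := Nat.prime_iff_prime_int.mp hp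
  have hp2 : p ≠ 2 := by
    rintro rfl
    revert h
    decide +kernel
  rw [← legendreSym_neg_seven hp2] at h
  have := legendreSym.prime_dvd_of_eq_neg_one h (x := 2 * a + b) (y := b) (by
    have e : (2 * a + b) ^ 2 - -7 * b ^ 2 = 4 * normForm a b := by simp only [normForm]; ring
    rw [e]; exact hd.mul_left 4)
  refine ⟨?_, this.2⟩
  have h2 : (p : ℤ) ∣ 2 * a := by simpa using dvd_sub this.1 this.2
  refine (hp'.dvd_or_dvd h2).resolve_left fun h => hp2 ?_
  have : p ∣ 2 := by exact_mod_cast h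
  exact (Nat.prime_dvd_prime_iff_eq hp (by norm_num)).mp this

lemma ncard_normReps_inert {p : ℕ} (hp : p.Prime) (h : legendreSym 7 p = -1) (n : ℕ) :
    (normReps (p * n)).ncard = if p ∣ n then (normReps (n / p)).ncard else 0 := by
  rw [← normReps_dvd_card hp]
  congr 1
  ext z
  simp only [Set.mem_ofPred_eq, iff_self_and]
  intro hz
  apply dvd_of_dvd_normForm hp h
  simp only [normReps, Set.mem_ofPred_eq] at hz
  rw [hz]; push_cast; exact dvd_mul_right _ _

/-- The lemma of Thue on small solutions of a linear congruence modulo a prime. -/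
lemma exists_small_congruent {p : ℕ} (hp : p.Prime) (t : ℤ) :
    ∃ u v : ℤ, (u ≠ 0 ∨ v ≠ 0) ∧ u ^ 2 < p ∧ v ^ 2 < p ∧ (p : ℤ) ∣ u - t * v := by
  have : NeZero p := ⟨hp.ne_zero⟩
  set s := Nat.sqrt p
  have hs : s * s < p := lt_of_le_of_ne (Nat.sqrt_le p) fun h => by
    have : IsSquare p := ⟨s, h.symm⟩
    exact (Nat.prime_iff_prime_int.mp hp).irreducible.not_isSquare (by
      obtain ⟨r, hr⟩ := this; exact ⟨r, by exact_mod_cast hr⟩)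
  have hlt := Nat.lt_succ_sqrt p
  obtain ⟨x, hx, y, hy, hne, he⟩ := Finset.exists_ne_map_eq_of_card_lt_of_maps_to
    (s := Finset.range (s + 1) ×ˢ Finset.range (s + 1)) (t := (Finset.univ : Finset (ZMod p)))
    (by simpa [ZMod.card] using hlt)
    (f := fun x => (x.1 : ZMod p) - t * x.2) (fun _ _ => Finset.mem_coe.mpr (Finset.mem_univ _))
  simp only [Finset.mem_product, Finset.mem_range] at hx hy
  have hsq : ∀ a b : ℕ, a < s + 1 → b < s + 1 → ((a : ℤ) - b) ^ 2 < p := fun a b ha hb => by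
    have : ((a : ℤ) - b) ^ 2 ≤ (s : ℤ) ^ 2 := sq_le_sq' (by lia) (by lia)
    have hs' : (s : ℤ) * s < p := by exact_mod_cast hs
    linarith [sq (s : ℤ)]
  refine ⟨x.1 - y.1, x.2 - y.2, ?_, hsq _ _ hx.1 hy.1, hsq _ _ hx.2 hy.2, ?_⟩
  · by_contra! h
    exact hne (Prod.ext (by lia) (by lia))
  · rw [← ZMod.intCast_zmod_eq_zero_iff_dvd]
    push_cast
    linear_combination he

lemma exists_normForm_eq {p : ℕ} (hp : p.Prime) (h : legendreSym 7 p = 1) :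
    ∃ u v : ℤ, normForm u v = p := by
  have : Fact p.Prime := ⟨hp⟩
  rcases eq_or_ne p 2 with rfl | hp2
  · exact ⟨0, 1, by norm_num [normForm]⟩
  obtain ⟨t, ht⟩ : ∃ t : ℤ, (p : ℤ) ∣ t ^ 2 + t + 2 := by
    rw [← legendreSym_neg_seven hp2] at h
    have h0 : ((-7 : ℤ) : ZMod p) ≠ 0 := by
      intro h0
      rw [(legendreSym.eq_zero_iff p _).mpr h0] at h
      norm_num at h
    obtain ⟨r, hr⟩ := (legendreSym.eq_one_iff p h0).mp h
    have h2 : (2 : ZMod p) ≠ 0 := by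
      intro h2
      have : p ∣ 2 := by rw [← ZMod.natCast_eq_zero_iff]; exact_mod_cast h2
      exact hp2 ((Nat.prime_dvd_prime_iff_eq hp (by norm_num)).mp this)
    obtain ⟨t, ht⟩ := ZMod.intCast_surjective ((r - 1) / 2 : ZMod p)
    refine ⟨t, ?_⟩
    rw [← ZMod.intCast_zmod_eq_zero_iff_dvd]
    push_cast at hr ⊢
    rw [ht]
    field_simp
    linear_combination -hr
  obtain ⟨u, v, hne, hu, hv, hd⟩ := exists_small_congruent hp t
  obtain ⟨k, hk⟩ : (p : ℤ) ∣ normForm u v := by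
    have : normForm u v = (u - t * v) * (u + t * v + v) + (t ^ 2 + t + 2) * v ^ 2 := by
      simp only [normForm]; ring
    rw [this]
    exact dvd_add (hd.mul_right _) (ht.mul_right _)
  have hp0 : (0 : ℤ) < p := by exact_mod_cast hp.pos
  have hpos : 0 < normForm u v := by
    have h4 : 4 * normForm u v = (2 * u + v) ^ 2 + 7 * v ^ 2 := by simp only [normForm]; ring
    by_cases hv0 : v = 0
    · have : u ≠ 0 := by tauto
      subst hv0
      have := sq_pos_of_ne_zero this
      nlinarith
    · have := sq_pos_of_ne_zero hv0
      nlinarith [sq_nonneg (2 * u + v)]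
  have hlt : normForm u v < 4 * p := by
    simp only [normForm]
    nlinarith [sq_nonneg (u - v)]
  have hk0 : 0 < k := by
    by_contra! h; nlinarith
  have hk4 : k < 4 := by
    by_contra! h; nlinarith
  have hcases : k = 1 ∨ k = 2 ∨ k = 3 := by lia
  rcases hcases with rfl | rfl | rfl
  · exact ⟨u, v, by rw [hk]; ring⟩
  · simp only [normForm] at hk
    have : Even (u * (u + v)) := ⟨p - v ^ 2, by linear_combination hk⟩
    rcases Int.even_mul.mp this with ⟨w, hw⟩ | ⟨w, hw⟩
    · refine ⟨v, w, ?_⟩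
      subst hw
      simp only [normForm]; linarith
    · refine ⟨-v, w, ?_⟩
      obtain rfl : u = w + w - v := by linarith
      simp only [normForm]; linarith
  · exfalso
    have h3 := dvd_of_dvd_normForm (p := 3) (by norm_num) (by decide +kernel) (a := u) (b := v)
      (by rw [hk]; exact dvd_mul_left _ _)
    obtain ⟨⟨c, rfl⟩, d, rfl⟩ := h3
    have : (p : ℤ) = 3 * normForm c d := by
      simp only [normForm] at hk ⊢; push_cast at hk; linarith
    have h3p : 3 ∣ p := by
      rw [← Int.natCast_dvd_natCast]; exact ⟨_, this⟩
    have := (Nat.prime_dvd_prime_iff_eq (by norm_num) hp).mp h3p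
    subst this
    revert h
    decide +kernel

lemma ncard_normReps_prime_mul {p : ℕ} (hp : p.Prime) (n : ℕ) :
    ((normReps (p * n)).ncard : ℤ) = (1 + legendreSym 7 p) * (normReps n).ncard -
      legendreSym 7 p * (if p ∣ n then (normReps (n / p)).ncard else 0 : ℕ) := by
  by_cases h0 : ((p : ℤ) : ZMod 7) = 0
  · have h7 : 7 = p := by
      have : 7 ∣ p := by
        rw [← ZMod.natCast_eq_zero_iff]; exact_mod_cast h0
      exact (Nat.prime_dvd_prime_iff_eq (by norm_num) hp).mp this
    rw [(legendreSym.eq_zero_iff 7 _).mpr h0]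
    subst h7
    rw [ncard_normReps_seven]; ring
  · have hp7 : p ≠ 7 := by
      rintro rfl
      exact h0 (by decide +kernel)
    rcases legendreSym.eq_one_or_neg_one 7 h0 with h | h
    · obtain ⟨u, v, huv⟩ := exists_normForm_eq hp h
      rw [ncard_normReps_split hp hp7 huv, h]; ring
    · rw [ncard_normReps_inert hp h, h]; ring

lemma charSum_prime_mul {p : ℕ} (hp : p.Prime) {n : ℕ} (hn : n ≠ 0) :
    charSum (p * n) = (1 + legendreSym 7 p) * charSum n -
      legendreSym 7 p * (if p ∣ n then charSum (n / p) else 0) := by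
  have hp0 := hp.ne_zero
  have hinj : Function.Injective (p * ·) := mul_right_injective₀ hp0
  have himg : ∀ m : ℕ, ∑ d ∈ m.divisors.image (p * ·), legendreSym 7 d =
      legendreSym 7 p * charSum m := fun m => by
    rw [Finset.sum_image hinj.injOn, charSum, Finset.mul_sum]
    exact Finset.sum_congr rfl fun d _ => by push_cast; rw [legendreSym.mul]
  have hunion : (p * n).divisors = n.divisors ∪ n.divisors.image (p * ·) := by
    ext d
    simp only [Nat.mem_divisors, Finset.mem_union, Finset.mem_image]
    constructor
    · rintro ⟨hd, -⟩
      by_cases hpd : p ∣ d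
      · obtain ⟨e, rfl⟩ := hpd
        exact Or.inr ⟨e, ⟨Nat.dvd_of_mul_dvd_mul_left hp.pos hd, hn⟩, rfl⟩
      · exact Or.inl ⟨((Nat.Prime.coprime_iff_not_dvd hp).mpr hpd).symm.dvd_of_dvd_mul_left hd, hn⟩
    · rintro (⟨hd, -⟩ | ⟨e, ⟨he, -⟩, rfl⟩)
      · exact ⟨hd.mul_left _, mul_ne_zero hp0 hn⟩
      · exact ⟨mul_dvd_mul_left _ he, mul_ne_zero hp0 hn⟩
  have hinter : ∑ d ∈ n.divisors ∩ n.divisors.image (p * ·), legendreSym 7 d =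
      legendreSym 7 p * (if p ∣ n then charSum (n / p) else 0) := by
    split_ifs with h
    · obtain ⟨m, rfl⟩ := h
      rw [Nat.mul_div_cancel_left _ hp.pos, ← himg]
      congr 1
      ext d
      simp only [Nat.mem_divisors, Finset.mem_inter, Finset.mem_image]
      constructor
      · rintro ⟨⟨hd, -⟩, e, -, rfl⟩
        exact ⟨e, ⟨Nat.dvd_of_mul_dvd_mul_left hp.pos hd, right_ne_zero_of_mul hn⟩, rfl⟩
      · rintro ⟨e, ⟨he, -⟩, rfl⟩
        exact ⟨⟨mul_dvd_mul_left _ he, hn⟩, e, ⟨he.mul_left _, hn⟩, rfl⟩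
    · rw [mul_zero]
      convert Finset.sum_empty
      ext d
      simp only [Nat.mem_divisors, Finset.mem_inter, Finset.mem_image, Finset.notMem_empty,
        iff_false]
      rintro ⟨⟨hd, -⟩, e, -, rfl⟩
      exact h ((dvd_mul_right _ _).trans hd)
  have := Finset.sum_union_inter (s₁ := n.divisors) (s₂ := n.divisors.image (p * ·))
    (f := fun d : ℕ => legendreSym 7 d)
  rw [← hunion, hinter, himg] at this
  change charSum (p * n) + _ = charSum n + _ at this
  linarith

lemma ncard_normReps_one : (normReps 1).ncard = 2 := by
  have : normReps 1 = {((1 : ℤ), (0 : ℤ)), (-1, 0)} := by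
    ext ⟨a, b⟩
    simp only [normReps, normForm, Set.mem_ofPred_eq, Set.mem_insert_iff, Set.mem_singleton_iff,
      Prod.mk.injEq]
    constructor
    · intro h
      push_cast at h
      have hb : b = 0 := by
        by_contra hb
        have := Int.add_one_le_iff.mpr (sq_pos_of_ne_zero hb)
        nlinarith [sq_nonneg (2 * a + b)]
      subst hb
      have : (a - 1) * (a + 1) = 0 := by linear_combination h
      rcases mul_eq_zero.mp this with h | h
      · left; constructor <;> lia
      · right; constructor <;> lia
    · rintro (⟨rfl, rfl⟩ | ⟨rfl, rfl⟩) <;> norm_num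
  rw [this, Set.ncard_pair (by decide)]

/-- The number of representations by the norm form of `ℚ(√-7)`. -/
theorem ncard_normReps {n : ℕ} (hn : n ≠ 0) : ((normReps n).ncard : ℤ) = 2 * charSum n := by
  induction n using Nat.strong_induction_on with
  | _ n ih =>
    rcases eq_or_ne n 1 with rfl | h1
    · rw [ncard_normReps_one]
      simp [charSum, legendreSym.at_one]
    · obtain ⟨p, hp, m, rfl⟩ := Nat.exists_prime_and_dvd h1
      have hm0 : m ≠ 0 := right_ne_zero_of_mul hn
      have hmpos := Nat.pos_of_ne_zero hm0
      rw [ncard_normReps_prime_mul hp, charSum_prime_mul hp hm0,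
        ih m (by nlinarith [hp.two_le]) hm0]
      split_ifs with hd
      · rw [ih (m / p) ((Nat.div_le_self _ _).trans_lt (by nlinarith [hp.two_le]))
          (Nat.div_pos (Nat.le_of_dvd hmpos hd) hp.pos).ne']
        ring
      · push_cast; ring

lemma ncard_diagReps_odd {n : ℕ} (hn : ¬ 2 ∣ n) : (diagReps n).ncard = (normReps n).ncard := by
  have hinj : Function.Injective fun z : ℤ × ℤ => (z.1 - z.2, 2 * z.2) := by
    intro x y h
    simp only [Prod.mk.injEq] at h
    exact Prod.ext (by lia) (by lia)
  rw [← Set.ncard_image_of_injective (diagReps n) hinj]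
  congr 1
  ext ⟨a, b⟩
  simp only [diagReps, normReps, normForm, Set.mem_image, Set.mem_ofPred_eq, Prod.exists,
    Prod.mk.injEq]
  constructor
  · rintro ⟨x, y, h, rfl, rfl⟩
    rw [← h]; ring
  · intro h
    have hodd : ¬ Even (a * (a + b)) := by
      rintro ⟨k, hk⟩
      exact hn (by rw [← Int.natCast_dvd_natCast]; exact ⟨k + b ^ 2, by push_cast; linarith⟩)
    rw [Int.even_mul, Int.even_add, not_or] at hodd
    obtain ⟨y, hy⟩ : Even b := by tauto
    refine ⟨a + y, y, ?_, by ring, by lia⟩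
    subst hy
    rw [← h]; ring

lemma ncard_diagReps_four_mul (n : ℕ) : (diagReps (4 * n)).ncard = (normReps n).ncard := by
  have hinj : Function.Injective fun z : ℤ × ℤ => (2 * z.1 + z.2, z.2) := by
    intro x y h
    simp only [Prod.mk.injEq] at h
    exact Prod.ext (by lia) (by lia)
  rw [← Set.ncard_image_of_injective (normReps n) hinj]
  congr 1
  ext ⟨x, y⟩
  simp only [diagReps, normReps, normForm, Set.mem_image, Set.mem_ofPred_eq, Prod.exists,
    Prod.mk.injEq]
  constructor
  · intro h
    push_cast at h
    have heven : Even ((x - y) * (x + y)) := ⟨2 * n - 4 * y ^ 2, by linear_combination h⟩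
    rw [Int.even_mul, Int.even_add, Int.even_sub, or_self] at heven
    obtain ⟨a, ha⟩ := Int.even_sub.mpr heven
    refine ⟨a, y, ?_, by lia, rfl⟩
    obtain rfl : x = a + a + y := by linarith
    linarith
  · rintro ⟨a, b, h, rfl, rfl⟩
    push_cast
    rw [← h]; ring

lemma ncard_diagReps_two_mul {n : ℕ} (hn : ¬ 2 ∣ n) : (diagReps (2 * n)).ncard = 0 := by
  suffices h : diagReps (2 * n) = ∅ by rw [h, Set.ncard_empty]
  ext ⟨x, y⟩
  simp only [diagReps, Set.mem_ofPred_eq, Set.mem_empty_iff_false, iff_false]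
  intro h
  push_cast at h
  have heven : Even ((x - y) * (x + y)) := ⟨n - 4 * y ^ 2, by linear_combination h⟩
  rw [Int.even_mul, Int.even_add, Int.even_sub, or_self] at heven
  obtain ⟨a, ha⟩ := Int.even_sub.mpr heven
  obtain rfl : x = a + a + y := by linarith
  exact hn (by
    rw [← Int.natCast_dvd_natCast]
    exact ⟨a ^ 2 + a * y + 2 * y ^ 2, by push_cast; linarith⟩)

lemma charSum_two_mul {n : ℕ} (hn : n ≠ 0) :
    charSum (2 * n) = 2 * charSum n - (if 2 ∣ n then charSum (n / 2) else 0) := by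
  have h2 : legendreSym 7 ((2 : ℕ) : ℤ) = 1 := by decide +kernel
  rw [charSum_prime_mul Nat.prime_two hn, h2]
  ring

/-- The number of representations of a positive integer by `x² + 7y²`. -/
theorem ncard_diagReps {n : ℕ} (hn : n ≠ 0) :
    ((diagReps n).ncard : ℤ) = 2 * (charSum n - 2 * (if 2 ∣ n then charSum (n / 2) else 0) +
      2 * (if 4 ∣ n then charSum (n / 4) else 0)) := by
  by_cases h2 : 2 ∣ n
  · obtain ⟨m, rfl⟩ := h2
    have hm : m ≠ 0 := right_ne_zero_of_mul hn
    by_cases h2' : 2 ∣ m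
    · obtain ⟨k, rfl⟩ := h2'
      have hk : k ≠ 0 := right_ne_zero_of_mul hm
      have e : 2 * (2 * k) = 4 * k := by ring
      have h := charSum_two_mul hm
      rw [if_pos (dvd_mul_right _ _), Nat.mul_div_cancel_left _ two_pos] at h
      rw [if_pos (dvd_mul_right _ _), Nat.mul_div_cancel_left _ two_pos, h, e,
        if_pos (dvd_mul_right _ _), Nat.mul_div_cancel_left _ four_pos, ncard_diagReps_four_mul,
        ncard_normReps hk]
      ring
    · have h4 : ¬ 4 ∣ 2 * m := by lia
      rw [ncard_diagReps_two_mul h2', charSum_two_mul hm, if_neg h2', if_neg h4,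
        if_pos (dvd_mul_right _ _), Nat.mul_div_cancel_left _ two_pos]
      push_cast; ring
  · have h4 : ¬ 4 ∣ n := by lia
    rw [ncard_diagReps_odd h2, ncard_normReps hn, if_neg h2, if_neg h4]
    ring

lemma ncard_diagReps_zero : (diagReps 0).ncard = 1 := by
  have : diagReps 0 = {(0, 0)} := by
    ext ⟨x, y⟩
    simp only [diagReps, Set.mem_ofPred_eq, Set.mem_singleton_iff, Prod.mk.injEq]
    constructor
    · intro h
      push_cast at h
      have hx : x ^ 2 = 0 := by nlinarith [sq_nonneg x, sq_nonneg y]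
      have hy : y ^ 2 = 0 := by nlinarith [sq_nonneg x, sq_nonneg y]
      exact ⟨pow_eq_zero_iff two_ne_zero |>.mp hx, pow_eq_zero_iff two_ne_zero |>.mp hy⟩
    · rintro ⟨rfl, rfl⟩; norm_num
  rw [this, Set.ncard_singleton]

lemma summable_norm_zpow_sq {q : ℂ} (hq : ‖q‖ < 1) : Summable fun n : ℤ => ‖q ^ (n ^ 2)‖ := by
  have key : Summable fun n : ℕ => ‖q ^ ((n : ℤ) ^ 2)‖ := by
    refine Summable.of_nonneg_of_le (fun _ => norm_nonneg _) (fun n => ?_)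
      (summable_geometric_of_lt_one (norm_nonneg q) hq)
    have : q ^ ((n : ℤ) ^ 2) = q ^ (n ^ 2) := by exact_mod_cast zpow_natCast q (n ^ 2)
    rw [this, norm_pow]
    exact pow_le_pow_of_le_one (norm_nonneg q) hq.le (Nat.le_self_pow two_ne_zero n)
  refine Summable.of_nat_of_neg key ?_
  simpa only [neg_sq] using key

lemma norm_pow_lt_one {q : ℂ} (hq : ‖q‖ < 1) {k : ℕ} (hk : k ≠ 0) : ‖q ^ k‖ < 1 := by
  rw [norm_pow]; exact pow_lt_one₀ (norm_nonneg _) hq hk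

lemma hasSum_diagReps {q : ℂ} (hq : ‖q‖ < 1) :
    HasSum (fun n : ℕ => ((diagReps n).ncard : ℂ) * q ^ n)
      ((∑' n : ℤ, q ^ (n ^ 2)) * ∑' n : ℤ, (q ^ 7) ^ (n ^ 2)) := by
  have h1 := summable_norm_zpow_sq hq
  have h2 := summable_norm_zpow_sq (norm_pow_lt_one hq (k := 7) (by norm_num))
  rw [tsum_mul_tsum_of_summable_norm h1 h2]
  have h := (summable_mul_of_summable_norm h1 h2).hasSum.tsum_fiberwise
    fun z : ℤ × ℤ => z.1.natAbs ^ 2 + 7 * z.2.natAbs ^ 2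
  refine HasSum.congr_fun h fun n => ?_
  have hset : diagReps n =
      (fun z : ℤ × ℤ => z.1.natAbs ^ 2 + 7 * z.2.natAbs ^ 2) ⁻¹' {n} := by
    ext z
    simp only [diagReps, Set.mem_ofPred_eq, Set.mem_preimage, Set.mem_singleton_iff]
    zify
    simp only [sq_abs]
  rw [hset, ← Nat.card_coe_set_eq, ← nsmul_eq_mul, ← tsum_const]
  refine tsum_congr fun z => ?_
  obtain ⟨z, hz⟩ := z
  simp only [Set.mem_preimage, Set.mem_singleton_iff] at hz
  have hcast : ∀ (r : ℂ) (x : ℤ), r ^ (x ^ 2) = r ^ (x.natAbs ^ 2) := fun r x => by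
    rw [← zpow_natCast]; push_cast; rw [sq_abs]
  rw [hcast, hcast, ← pow_mul, ← pow_add, hz]

/-- The Lambert series of the Legendre symbol mod 7, with its power series expansion. -/
lemma exists_hasSum_lambert {q : ℂ} (hq : ‖q‖ < 1) : ∃ L : ℂ,
    HasSum (fun j : ℕ => (legendreSym 7 ((j : ℤ) + 1) : ℂ) * (q ^ (j + 1) / (1 - q ^ (j + 1)))) L ∧
      HasSum (fun n : ℕ => (charSum n : ℂ) * q ^ n) L := by
  set F : ℕ × ℕ → ℂ := fun z => (legendreSym 7 ((z.1 : ℤ) + 1) : ℂ) * q ^ ((z.1 + 1) * (z.2 + 1))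
  have hbound : ∀ a : ℤ, ‖(legendreSym 7 a : ℂ)‖ ≤ 1 := fun a => by
    by_cases h0 : (a : ZMod 7) = 0
    · rw [(legendreSym.eq_zero_iff 7 a).mpr h0]; simp
    · rcases legendreSym.eq_one_or_neg_one 7 h0 with h | h <;> rw [h] <;> simp
  have hF : Summable F := by
    have hg := summable_geometric_of_lt_one (norm_nonneg q) hq
    refine Summable.of_norm_bounded (Summable.mul_of_nonneg hg hg (fun _ => by positivity)
      fun _ => by positivity) fun z => ?_
    rw [norm_mul, norm_pow, ← pow_add]
    calc _ ≤ 1 * ‖q‖ ^ ((z.1 + 1) * (z.2 + 1)) := by gcongr; exact hbound _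
      _ ≤ _ := by
        rw [one_mul]
        exact pow_le_pow_of_le_one (norm_nonneg q) hq.le (by nlinarith [Nat.zero_le (z.1 * z.2)])
  refine ⟨∑' z, F z, hF.hasSum.prod_fiberwise fun j => ?_, ?_⟩
  · have h := (hasSum_geometric_of_norm_lt_one
      (norm_pow_lt_one hq (k := j + 1) j.succ_ne_zero)).mul_left (q ^ (j + 1))
    rw [← div_eq_mul_inv] at h
    refine HasSum.congr_fun (h.mul_left (legendreSym 7 ((j : ℤ) + 1) : ℂ)) fun m => ?_
    simp only [F]
    rw [pow_mul, pow_succ' (q ^ (j + 1))]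
  · have h := hF.hasSum.tsum_fiberwise fun z : ℕ × ℕ => (z.1 + 1) * (z.2 + 1)
    refine HasSum.congr_fun h fun n => ?_
    rw [charSum, Int.cast_sum, Finset.sum_mul, ← Finset.tsum_subtype]
    let e : ((fun z : ℕ × ℕ => (z.1 + 1) * (z.2 + 1)) ⁻¹' {n}) ≃ n.divisors :=
      { toFun := fun z => ⟨z.1.1 + 1, by
          have hz := z.2
          simp only [Set.mem_preimage, Set.mem_singleton_iff] at hz
          have hpos : 0 < (z.1.1 + 1) * (z.1.2 + 1) := by positivity
          exact Nat.mem_divisors.mpr ⟨⟨_, hz.symm⟩, (hz ▸ hpos).ne'⟩⟩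
        invFun := fun d => ⟨(d.1 - 1, n / d.1 - 1), by
          obtain ⟨d, hd⟩ := d
          have hn := Nat.pos_of_mem_divisors hd
          have hd' := Nat.dvd_of_mem_divisors hd
          have hq := Nat.div_pos (Nat.divisor_le hd) hn
          simp only [Set.mem_preimage, Set.mem_singleton_iff]
          rw [Nat.sub_add_cancel hn, Nat.sub_add_cancel hq, Nat.mul_div_cancel' hd']⟩
        left_inv := fun z => by
          obtain ⟨⟨a, b⟩, hz⟩ := z
          simp only [Set.mem_preimage, Set.mem_singleton_iff] at hz
          subst hz
          simp
        right_inv := fun d => by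
          obtain ⟨d, hd⟩ := d
          have hn := Nat.pos_of_mem_divisors hd
          simp only [Subtype.mk.injEq]
          exact Nat.sub_add_cancel hn }
    rw [← e.tsum_eq]
    refine tsum_congr fun z => ?_
    have hz := z.2
    simp only [Set.mem_preimage, Set.mem_singleton_iff] at hz
    simp only [F, e, Equiv.coe_fn_mk, hz]
    push_cast
    rfl

/-- Reindexing of a power series in `q ^ k` as a power series in `q`. -/
lemma HasSum.pow_expand {c : ℕ → ℤ} {q L : ℂ} {k : ℕ} (hk : 0 < k)
    (h : HasSum (fun n : ℕ => (c n : ℂ) * (q ^ k) ^ n) L) :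
    HasSum (fun n : ℕ => ((if k ∣ n then c (n / k) else 0 : ℤ) : ℂ) * q ^ n) L := by
  have hinj : Function.Injective (k * · : ℕ → ℕ) := mul_right_injective₀ hk.ne'
  refine (hinj.hasSum_iff fun n hn => ?_).mp ?_
  · rw [if_neg fun ⟨m, hm⟩ => hn ⟨m, hm.symm⟩]; simp
  · convert h using 2 with n
    simp only [Function.comp_apply]
    rw [if_pos (dvd_mul_right _ _), Nat.mul_div_cancel_left _ hk, pow_mul]

theorem statement2 (q : ℂ) (hq : ‖q‖ < 1) :
    (∑' n : ℤ, (q) ^ (n ^ 2)) * (∑' n : ℤ, (q ^ 7) ^ (n ^ 2)) =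
      1 + 2 * ∑' j : ℕ, (legendreSym 7 ((j : ℤ) + 1) : ℂ) * (q ^ (1 * (j + 1)) / (1 - q ^ (1 * (j + 1))) - 2 * q ^ (2 * (j + 1)) / (1 - q ^ (2 * (j + 1))) + 2 * q ^ (4 * (j + 1)) / (1 - q ^ (4 * (j + 1)))) := by
  obtain ⟨L₁, hL₁, hc₁⟩ := exists_hasSum_lambert hq
  obtain ⟨L₂, hL₂, hc₂⟩ := exists_hasSum_lambert (norm_pow_lt_one hq two_ne_zero)
  obtain ⟨L₄, hL₄, hc₄⟩ := exists_hasSum_lambert (norm_pow_lt_one hq four_ne_zero)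
  have hlambert := (hL₁.sub (hL₂.mul_left 2)).add (hL₄.mul_left 2)
  have hcoeff := (((hc₁.sub ((hc₂.pow_expand two_pos).mul_left 2)).add
    ((hc₄.pow_expand four_pos).mul_left 2)).mul_left 2).add
      (hasSum_ite_eq (0 : ℕ) (1 : ℂ))
  have hR : ∀ n : ℕ, ((diagReps n).ncard : ℂ) * q ^ n =
      2 * ((charSum n : ℂ) * q ^ n -
        2 * (((if 2 ∣ n then charSum (n / 2) else 0 : ℤ) : ℂ) * q ^ n) +
        2 * (((if 4 ∣ n then charSum (n / 4) else 0 : ℤ) : ℂ) * q ^ n)) +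
        (if n = 0 then 1 else 0) := fun n => by
    rcases eq_or_ne n 0 with rfl | hn
    · simp [ncard_diagReps_zero, charSum]
    · have h : ((diagReps n).ncard : ℂ) = _ := congrArg (Int.cast : ℤ → ℂ) (ncard_diagReps hn)
      rw [h, if_neg hn]
      push_cast
      ring
  rw [(hasSum_diagReps hq).unique (by simpa only [hR] using hcoeff), add_comm]
  congr 2
  rw [← hlambert.tsum_eq]
  refine tsum_congr fun j => ?_
  rw [one_mul, pow_mul q 2, pow_mul q 4]
  ring
end
end

section
/- For |q|<1, q·ψ(q)·ψ(q⁷) = ∑_{j≥1} χ₇(j)·( q^j/(1−q^j) − q^{2j}/(1−q^{2j}) ), where χ₇ is the Legendre symbol mod 7. -/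
noncomputable section

/-- The ring of integers `ℤ[ω]`, `ω² = ω - 2`, of `ℚ(√-7)`. -/
abbrev KleinianInt := QuadraticAlgebra ℤ (-2) 1

namespace KleinianInt

open QuadraticAlgebra

theorem norm_eq (z : KleinianInt) : z.norm = z.re ^ 2 + z.re * z.im + 2 * z.im ^ 2 := by
  rw [norm_def]; ring

theorem mul_star_self (z : KleinianInt) : z * star z = ((z.norm : ℤ) : KleinianInt) := by
  rw [← algebraMap_norm_eq_mul_star]; rfl

theorem mul_left_cancel_of_norm_ne_zero {a u v : KleinianInt} (ha : a.norm ≠ 0)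
    (h : a * u = a * v) : u = v := by
  have := norm_mem_nonZeroDivisors_iff.1 (mem_nonZeroDivisors_of_ne_zero ha)
  exact (mul_cancel_left_mem_nonZeroDivisors this).1 h

theorem intCast_dvd_iff (k : ℤ) (z : KleinianInt) :
    (k : KleinianInt) ∣ z ↔ k ∣ z.re ∧ k ∣ z.im := by
  constructor
  · rintro ⟨u, rfl⟩
    simp
  · rintro ⟨⟨a, ha⟩, ⟨b, hb⟩⟩
    exact ⟨⟨a, b⟩, by ext <;> simp [ha, hb]⟩

/-- The elements of norm `n` not divisible by `ω`. -/
def oddReps (n : ℤ) : Set KleinianInt := {z | Odd z.re ∧ z.norm = n}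

theorem finite_oddReps (n : ℤ) : (oddReps n).Finite := by
  refine (((Set.finite_Icc (-(8 * n)) (8 * n)).prod (Set.finite_Icc (-(8 * n)) (8 * n))).image
    (fun p : ℤ × ℤ => (⟨p.1, p.2⟩ : KleinianInt))).subset ?_
  rintro z ⟨-, hz⟩
  rw [norm_eq] at hz
  have h1 : z.re ^ 2 ≤ 8 * n := by nlinarith [sq_nonneg (4 * z.im + z.re), sq_nonneg z.re]
  have h2 : z.im ^ 2 ≤ 8 * n := by nlinarith [sq_nonneg (2 * z.re + z.im), sq_nonneg z.im]
  have key : ∀ a : ℤ, a ^ 2 ≤ 8 * n → a ∈ Set.Icc (-(8 * n)) (8 * n) := fun a ha =>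
    abs_le.1 ((Int.le_self_sq |a|).trans ((sq_abs a).trans_le ha))
  exact ⟨(z.re, z.im), ⟨key _ h1, key _ h2⟩, rfl⟩

theorem ncard_oddReps_one : (oddReps 1).ncard = 2 := by
  have : oddReps 1 = {1, -1} := by
    ext z
    simp only [oddReps, Set.mem_ofPred_eq, Set.mem_insert_iff, Set.mem_singleton_iff]
    constructor
    · rintro ⟨-, h⟩
      rw [norm_eq] at h
      have h0 : z.im = 0 := by
        have : z.im ^ 2 < 1 := by nlinarith [sq_nonneg (2 * z.re + z.im)]
        nlinarith [sq_nonneg z.im, pow_eq_zero_iff (two_ne_zero) |>.1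
          (le_antisymm (by linarith) (sq_nonneg z.im) : z.im ^ 2 = 0)]
      rw [h0] at h
      have h1 : z.re ^ 2 = 1 := by linarith
      rcases sq_eq_one_iff.1 h1 with h | h
      · left; ext <;> simp [h, h0]
      · right; ext <;> simp [h, h0]
    · rintro (rfl | rfl) <;> simp
  rw [this, Set.ncard_pair]
  intro h
  have := congrArg QuadraticAlgebra.re h
  simp at this

theorem odd_re_mul_iff {a : KleinianInt} (ha : Odd a.re) (u : KleinianInt) :
    Odd (a * u).re ↔ Odd u.re := by
  have : (a * u).re = a.re * u.re - 2 * (a.im * u.im) := by simp; ring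
  rw [this, Int.odd_sub, Int.odd_mul]
  simp [ha]

theorem odd_re_of_odd_norm {a : KleinianInt} (ha : Odd a.norm) : Odd a.re := by
  rw [norm_eq, show a.re ^ 2 + a.re * a.im + 2 * a.im ^ 2 =
    a.re * (a.re + a.im) + 2 * a.im ^ 2 by ring, Int.odd_add, Int.odd_mul] at ha
  simp at ha
  exact ha.1

theorem ncard_oddReps_dvd {a : KleinianInt} (ha : Odd a.re) (ha0 : a.norm ≠ 0) (n : ℤ) :
    {z ∈ oddReps (a.norm * n) | a ∣ z}.ncard = (oddReps n).ncard := by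
  rw [← Set.ncard_image_of_injective (oddReps n)
    (fun _ _ h => mul_left_cancel_of_norm_ne_zero ha0 h : Function.Injective (a * ·))]
  congr 1
  ext z
  simp only [oddReps, Set.mem_ofPred_eq, Set.mem_image]
  constructor
  · rintro ⟨⟨h1, h2⟩, u, rfl⟩
    refine ⟨u, ⟨(odd_re_mul_iff ha u).1 h1, ?_⟩, rfl⟩
    rw [map_mul] at h2
    exact mul_left_cancel₀ ha0 h2
  · rintro ⟨u, ⟨h1, h2⟩, rfl⟩
    exact ⟨⟨(odd_re_mul_iff ha u).2 h1, by rw [map_mul, h2]⟩, dvd_mul_right a u⟩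

theorem ncard_oddReps_mul_of_forall_dvd {a : KleinianInt} (ha : Odd a.re) (ha0 : a.norm ≠ 0)
    {n : ℤ} (h : ∀ z ∈ oddReps (a.norm * n), a ∣ z) :
    (oddReps (a.norm * n)).ncard = (oddReps n).ncard := by
  rw [← ncard_oddReps_dvd ha ha0 n]
  congr 1
  ext z
  exact ⟨fun hz => ⟨hz, h z hz⟩, fun hz => hz.1⟩

theorem ncard_oddReps_two_mul (n : ℤ) : (oddReps (2 * n)).ncard = (oddReps n).ncard := by
  have hN : norm (⟨1, -1⟩ : KleinianInt) = 2 := by rw [norm_eq]; norm_num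
  rw [← hN]
  refine ncard_oddReps_mul_of_forall_dvd (by simp) (by rw [hN]; norm_num) ?_
  rintro z ⟨h1, h2⟩
  rw [hN, norm_eq] at h2
  have h3 : Even (z.re * (z.re + z.im)) := ⟨n - z.im ^ 2, by linarith⟩
  rw [Int.even_mul] at h3
  obtain ⟨k, hk⟩ := h3.resolve_left (Int.not_even_iff_odd.2 h1)
  exact ⟨⟨-z.im, k⟩, by ext <;> simp; linarith⟩

theorem dvd_of_dvd_im_mul_star {p : ℕ} (hp : p.Prime) {a z : KleinianInt} (ha : a.norm = p)
    (h : (p : ℤ) ∣ (z * star a).im) : a ∣ z := by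
  have hp' := Nat.prime_iff_prime_int.1 hp
  set w := z * star a with hw
  have hwN : w.norm = z.norm * p := by rw [hw, map_mul, QuadraticAlgebra.norm_star, ha]
  have hre : (p : ℤ) ∣ w.re := by
    rw [norm_eq] at hwN
    refine hp'.dvd_of_dvd_pow (n := 2) ?_
    have : w.re ^ 2 = z.norm * p - w.im * (w.re + 2 * w.im) := by linarith
    rw [this]
    exact dvd_sub (dvd_mul_left _ _) (h.mul_right _)
  obtain ⟨u, hu⟩ := (intCast_dvd_iff p w).2 ⟨hre, h⟩
  refine ⟨u, mul_left_cancel_of_norm_ne_zero (a := star a) ?_ ?_⟩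
  · rw [QuadraticAlgebra.norm_star, ha]; exact hp'.ne_zero
  · rw [← mul_assoc, mul_comm (star a) a, mul_star_self, ha, ← hu, hw, mul_comm]

theorem ncard_oddReps_seven_mul (n : ℤ) : (oddReps (7 * n)).ncard = (oddReps n).ncard := by
  have hN : norm (⟨-1, 2⟩ : KleinianInt) = 7 := by rw [norm_eq]; norm_num
  have h7 : Prime (7 : ℤ) := by norm_num
  rw [← hN]
  refine ncard_oddReps_mul_of_forall_dvd (by simp) (by rw [hN]; norm_num) ?_
  rintro z ⟨-, h2⟩
  rw [hN] at h2
  refine dvd_of_dvd_im_mul_star (p := 7) (by norm_num) (by rw [hN]; norm_num) ?_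
  rw [norm_eq] at h2
  have h3 : (7 : ℤ) ∣ (2 * z.re + z.im) ^ 2 := ⟨4 * n - z.im ^ 2, by linarith⟩
  obtain ⟨k, hk⟩ := h7.dvd_of_dvd_pow h3
  refine ⟨-k, ?_⟩
  simp
  linarith

theorem ncard_oddReps_natCast_dvd {p : ℕ} (hp : p.Prime) (hp2 : p ≠ 2) (n : ℕ) :
    {z ∈ oddReps ((p * n : ℕ) : ℤ) | (p : KleinianInt) ∣ z}.ncard =
      if p ∣ n then (oddReps ((n / p : ℕ) : ℤ)).ncard else 0 := by
  have hN : norm (p : KleinianInt) = (p : ℤ) ^ 2 := norm_natCast p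
  have hp0 : (p : ℤ) ≠ 0 := by exact_mod_cast hp.ne_zero
  split_ifs with h
  · obtain ⟨m, rfl⟩ := h
    rw [Nat.mul_div_cancel_left _ hp.pos, ← ncard_oddReps_dvd (a := (p : KleinianInt)) ?_ ?_ m, hN]
    · push_cast; ring_nf
    · simpa using hp.odd_of_ne_two hp2
    · rw [hN]; positivity
  · rw [Set.ncard_eq_zero ((finite_oddReps _).subset (Set.sep_subset _ _))]
    ext z
    simp only [oddReps, Set.mem_ofPred_eq, Set.mem_empty_iff_false, iff_false]
    rintro ⟨⟨-, h2⟩, u, rfl⟩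
    rw [map_mul, hN] at h2
    push_cast at h2
    apply h
    have : (p : ℤ) * u.norm = n := mul_left_cancel₀ hp0 (by linarith)
    exact Int.natCast_dvd_natCast.1 ⟨_, this.symm⟩

theorem dvd_of_legendreSym_eq_neg_one {p : ℕ} [hp : Fact p.Prime] (hp2 : p ≠ 2)
    (h : legendreSym p (-7) = -1) {z : KleinianInt} (hz : (p : ℤ) ∣ z.norm) :
    (p : KleinianInt) ∣ z := by
  have hp' := Nat.prime_iff_prime_int.1 hp.out
  obtain ⟨h1, h2⟩ := legendreSym.prime_dvd_of_eq_neg_one h (x := 2 * z.re + z.im) (y := z.im) (by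
    obtain ⟨k, hk⟩ := hz
    rw [norm_eq] at hk
    exact ⟨4 * k, by linear_combination 4 * hk⟩)
  refine (intCast_dvd_iff p z).2 ⟨?_, h2⟩
  have h3 : (p : ℤ) ∣ 2 * z.re := (dvd_add_left h2).1 h1
  refine (hp'.dvd_or_dvd h3).resolve_left fun h4 => hp2 ?_
  exact (Nat.prime_dvd_prime_iff_eq hp.out Nat.prime_two).1 (by exact_mod_cast h4)

/-- Descent: if `A ∣ N(b + ω)` then `b + ω` has a factor of norm `A`. -/
theorem exists_factor_of_dvd_norm (A : ℕ) (hA : 0 < A) (b : ℤ)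
    (h : (A : ℤ) ∣ norm (⟨b, 1⟩ : KleinianInt)) :
    ∃ u v : KleinianInt, u * v = ⟨b, 1⟩ ∧ u.norm = A := by
  induction A using Nat.strong_induction_on generalizing b with
  | _ A ih =>
  rcases Nat.lt_or_ge A 2 with hA2 | hA2
  · obtain rfl : A = 1 := by omega
    exact ⟨1, ⟨b, 1⟩, one_mul _, by simp⟩
  -- reduce `b` modulo `A` so that `|2 b + 1| ≤ A`
  obtain ⟨b', k, hb, hb1, hb2⟩ : ∃ b' k : ℤ, b = b' + k * A ∧ 2 * b' + 1 ≤ A ∧ -A ≤ 2 * b' + 1 := by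
    refine ⟨(b + A / 2) % A - A / 2, (b + A / 2) / A, ?_, ?_, ?_⟩
    · have := Int.emod_add_mul_ediv (b + A / 2) A
      linarith
    · have := Int.emod_lt_of_pos (b + A / 2) (b := A) (by omega)
      omega
    · have := Int.emod_nonneg (b + A / 2) (b := A) (by omega)
      omega
  have hN' : norm (⟨b', 1⟩ : KleinianInt) = b' ^ 2 + b' + 2 := by rw [norm_eq]; ring
  have hN : norm (⟨b, 1⟩ : KleinianInt) = b ^ 2 + b + 2 := by rw [norm_eq]; ring
  have h' : (A : ℤ) ∣ norm (⟨b', 1⟩ : KleinianInt) := by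
    have : norm (⟨b', 1⟩ : KleinianInt) =
        norm (⟨b, 1⟩ : KleinianInt) - A * (k * (2 * b' + k * A + 1)) := by
      rw [hN, hN', hb]; ring
    rw [this]
    exact dvd_sub h (dvd_mul_right _ _)
  obtain ⟨C, hC⟩ := h'
  have hA' : (2 : ℤ) ≤ A := by exact_mod_cast hA2
  have hCpos : 0 < C := by
    rw [hN'] at hC
    by_contra hC0
    nlinarith [sq_nonneg (2 * b' + 1)]
  have hCA : C < A := by
    rw [hN'] at hC
    by_contra hC0
    nlinarith [mul_nonneg (sub_nonneg.2 hb1) (show 0 ≤ (A : ℤ) + (2 * b' + 1) by linarith)]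
  lift C to ℕ using hCpos.le
  obtain ⟨u, v, huv, hu⟩ := ih C (by exact_mod_cast hCA) (by exact_mod_cast hCpos) b'
    ⟨A, by rw [hC, mul_comm]⟩
  have hv : v.norm = A := by
    have := congrArg QuadraticAlgebra.norm huv
    rw [map_mul, hu, hC, mul_comm] at this
    exact mul_right_cancel₀ hCpos.ne' this
  refine ⟨v, u + k * star v, ?_, hv⟩
  have : v * (u + k * star v) = u * v + k * (v * star v) := by ring
  rw [this, huv, mul_star_self, hv]
  ext <;> simp [hb]

theorem exists_norm_eq_prime {p : ℕ} [hp : Fact p.Prime] (hp2 : p ≠ 2)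
    (h : legendreSym p (-7) = 1) : ∃ a : KleinianInt, a.norm = p := by
  have h0 : ((-7 : ℤ) : ZMod p) ≠ 0 := by
    intro h0
    rw [← legendreSym.eq_zero_iff, h] at h0
    exact one_ne_zero h0
  obtain ⟨c, hc⟩ := (legendreSym.eq_one_iff p h0).1 h
  have h2 : (2 : ZMod p) ≠ 0 := by
    intro h2
    have : ((2 : ℕ) : ZMod p) = 0 := by exact_mod_cast h2
    rw [ZMod.natCast_eq_zero_iff] at this
    exact hp2 ((Nat.prime_dvd_prime_iff_eq hp.out Nat.prime_two).1 this)
  obtain ⟨b, hb⟩ := ZMod.intCast_surjective ((c - 1) / 2)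
  obtain ⟨u, -, -, hu⟩ := exists_factor_of_dvd_norm p hp.out.pos b (by
    rw [← ZMod.intCast_zmod_eq_zero_iff_dvd, norm_eq]
    push_cast
    rw [hb]
    push_cast at hc
    field_simp
    linear_combination -hc)
  exact ⟨u, hu⟩

theorem dvd_or_star_dvd {p : ℕ} (hp : p.Prime) {a z : KleinianInt} (ha : a.norm = p)
    (hz : (p : ℤ) ∣ z.norm) : a ∣ z ∨ star a ∣ z := by
  have hp' := Nat.prime_iff_prime_int.1 hp
  have key : (z * star a).im * (z * star (star a)).im = z.im ^ 2 * p - a.im ^ 2 * z.norm := by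
    rw [← ha, norm_eq, norm_eq]; simp; ring
  have : (p : ℤ) ∣ (z * star a).im * (z * star (star a)).im := by
    rw [key]
    exact dvd_sub (dvd_mul_left _ _) (hz.mul_left _)
  rcases hp'.dvd_or_dvd this with h | h
  · exact .inl (dvd_of_dvd_im_mul_star hp ha h)
  · exact .inr (dvd_of_dvd_im_mul_star hp (by rw [QuadraticAlgebra.norm_star, ha]) h)

theorem natCast_dvd_of_dvd_of_star_dvd {p : ℕ} (hp : p.Prime) (hp7 : p ≠ 7)
    {a z : KleinianInt} (ha : a.norm = p) (h1 : a ∣ z) (h2 : star a ∣ z) :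
    (p : KleinianInt) ∣ z := by
  have hp' := Nat.prime_iff_prime_int.1 hp
  have e1 : (p : KleinianInt) ∣ z * star a := by
    obtain ⟨u, rfl⟩ := h1
    exact ⟨u, by rw [mul_right_comm, mul_star_self, ha]; simp⟩
  have e2 : (p : KleinianInt) ∣ z * a := by
    obtain ⟨u, rfl⟩ := h2
    exact ⟨u, by rw [mul_right_comm, mul_comm (star a), mul_star_self, ha]; simp⟩
  have e3 := (intCast_dvd_iff p _).1 (dvd_add e1 e2)
  have i1 := ((intCast_dvd_iff p _).1 e2).2
  have haN := ha
  rw [norm_eq] at haN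
  have hb : ¬ (p : ℤ) ∣ a.im := by
    rintro ⟨k, hk⟩
    have : (p : ℤ) ∣ a.re := by
      refine hp'.dvd_of_dvd_pow (n := 2) ⟨1 - k * a.re - 2 * k * a.im, ?_⟩
      rw [hk] at haN ⊢
      linear_combination haN
    obtain ⟨l, hl⟩ := this
    rw [hk, hl] at haN
    have : (p : ℤ) * (l ^ 2 + l * k + 2 * k ^ 2) = 1 :=
      mul_left_cancel₀ hp'.ne_zero (by linear_combination haN)
    exact hp'.not_dvd_one ⟨_, this.symm⟩
  have ht : ¬ (p : ℤ) ∣ 2 * a.re + a.im := by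
    intro h
    have h7 : (p : ℤ) ∣ 7 * a.im ^ 2 := by
      have : 7 * a.im ^ 2 = 4 * p - (2 * a.re + a.im) ^ 2 := by linear_combination 4 * haN
      rw [this]
      exact dvd_sub (dvd_mul_left _ _) (h.trans (dvd_pow_self _ two_ne_zero))
    rcases hp'.dvd_or_dvd h7 with h | h
    · exact hp7 ((Nat.prime_dvd_prime_iff_eq hp (by norm_num)).1 (by exact_mod_cast h))
    · exact hb (hp'.dvd_of_dvd_pow h)
  have hre : (p : ℤ) ∣ z.re ∧ (p : ℤ) ∣ z.im := by
    have him : (p : ℤ) ∣ z.im := by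
      have : (z * star a + z * a).im = z.im * (2 * a.re + a.im) := by simp; ring
      rw [this] at e3
      exact (hp'.dvd_or_dvd e3.2).resolve_right ht
    refine ⟨?_, him⟩
    have : z.re * a.im = (z * a).im - z.im * (a.re + a.im) := by simp; ring
    exact (hp'.dvd_or_dvd (this ▸ dvd_sub i1 (him.mul_right _))).resolve_right hb
  exact (intCast_dvd_iff p z).2 hre

theorem legendreSym_neg_seven {p : ℕ} [hp : Fact p.Prime] (hp2 : p ≠ 2) :
    legendreSym p (-7) = legendreSym 7 p := by
  rw [legendreSym.at_neg hp2]
  have := hp.out.eq_two_or_odd.resolve_left hp2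
  rcases (by omega : p % 4 = 1 ∨ p % 4 = 3) with h | h
  · rw [ZMod.χ₄_nat_one_mod_four h, one_mul]
    exact (legendreSym.quadratic_reciprocity_one_mod_four (p := p) (q := 7) h (by norm_num)).symm
  · rw [ZMod.χ₄_nat_three_mod_four h, neg_one_mul]
    exact (legendreSym.quadratic_reciprocity_three_mod_four (p := p) (q := 7) h rfl).symm

theorem ncard_oddReps_prime_mul {p : ℕ} (hp : p.Prime) (n : ℕ) :
    ((oddReps ((p * n : ℕ) : ℤ)).ncard : ℤ) + legendreSym 7 p * (p % 2 : ℕ) *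
      (if p ∣ n then ((oddReps ((n / p : ℕ) : ℤ)).ncard : ℤ) else 0) =
    (legendreSym 7 p + (p % 2 : ℕ)) * (oddReps (n : ℤ)).ncard := by
  rcases eq_or_ne p 2 with rfl | hp2
  · have : legendreSym 7 ((2 : ℕ) : ℤ) = 1 := by decide
    rw [this]
    have := ncard_oddReps_two_mul n
    simp [this]
  have hodd : p % 2 = 1 := hp.eq_two_or_odd.resolve_left hp2
  rcases eq_or_ne p 7 with rfl | hp7
  · have : legendreSym 7 ((7 : ℕ) : ℤ) = 0 := by decide
    rw [this]
    have := ncard_oddReps_seven_mul n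
    simp [this]
  have : Fact p.Prime := ⟨hp⟩
  have h0 : (((p : ℕ) : ℤ) : ZMod 7) ≠ 0 := by
    intro h
    rw [ZMod.intCast_zmod_eq_zero_iff_dvd] at h
    exact hp7 ((Nat.prime_dvd_prime_iff_eq (by norm_num) hp).1 (by exact_mod_cast h)).symm
  have hdvd : ∀ z ∈ oddReps ((p * n : ℕ) : ℤ), (p : ℤ) ∣ z.norm := by
    rintro z ⟨-, hz⟩
    rw [hz]
    push_cast
    exact dvd_mul_right _ _
  have hcount' : (if p ∣ n then ((oddReps ((n / p : ℕ) : ℤ)).ncard : ℤ) else 0) =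
      {z ∈ oddReps ((p * n : ℕ) : ℤ) | (p : KleinianInt) ∣ z}.ncard := by
    rw [ncard_oddReps_natCast_dvd hp hp2 n]; split_ifs <;> simp
  rw [hcount', hodd]
  rcases legendreSym.eq_one_or_neg_one 7 h0 with h | h
  · obtain ⟨a, ha⟩ := exists_norm_eq_prime hp2 ((legendreSym_neg_seven hp2).trans h)
    have haodd : Odd a.norm := by rw [ha]; exact_mod_cast hp.odd_of_ne_two hp2
    have ha0 : a.norm ≠ 0 := by rw [ha]; exact_mod_cast hp.ne_zero
    have c1 := ncard_oddReps_dvd (odd_re_of_odd_norm haodd) ha0 n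
    have c2 := ncard_oddReps_dvd (a := star a) (odd_re_of_odd_norm (by rwa [QuadraticAlgebra.norm_star]))
      (by rwa [QuadraticAlgebra.norm_star]) n
    rw [QuadraticAlgebra.norm_star] at c2
    rw [ha, ← Nat.cast_mul] at c1 c2
    have hfin := finite_oddReps ((p * n : ℕ) : ℤ)
    have hui := Set.ncard_union_add_ncard_inter
      {z ∈ oddReps ((p * n : ℕ) : ℤ) | a ∣ z} {z ∈ oddReps ((p * n : ℕ) : ℤ) | star a ∣ z}
      (hfin.subset (Set.sep_subset _ _)) (hfin.subset (Set.sep_subset _ _))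
    have hu : {z ∈ oddReps ((p * n : ℕ) : ℤ) | a ∣ z} ∪ {z ∈ oddReps ((p * n : ℕ) : ℤ) | star a ∣ z}
        = oddReps ((p * n : ℕ) : ℤ) := by
      rw [← Set.sep_or]
      exact Set.sep_eq_self_iff_mem_true.2 fun z hz => dvd_or_star_dvd hp ha (hdvd z hz)
    have hi : {z ∈ oddReps ((p * n : ℕ) : ℤ) | a ∣ z} ∩ {z ∈ oddReps ((p * n : ℕ) : ℤ) | star a ∣ z}
        = {z ∈ oddReps ((p * n : ℕ) : ℤ) | (p : KleinianInt) ∣ z} := by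
      rw [← Set.sep_and]
      ext z
      refine and_congr_right fun _ =>
        ⟨fun h => natCast_dvd_of_dvd_of_star_dvd hp hp7 ha h.1 h.2, fun h => ?_⟩
      have hpa : (p : KleinianInt) = a * star a := by rw [mul_star_self, ha]; simp
      rw [hpa] at h
      exact ⟨(dvd_mul_right _ _).trans h, (dvd_mul_left _ _).trans h⟩
    rw [hu, hi, c1, c2] at hui
    rw [h]
    push_cast
    linarith
  · have : {z ∈ oddReps ((p * n : ℕ) : ℤ) | (p : KleinianInt) ∣ z} = oddReps ((p * n : ℕ) : ℤ) :=
      Set.sep_eq_self_iff_mem_true.2 fun z hz =>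
        dvd_of_legendreSym_eq_neg_one hp2 ((legendreSym_neg_seven hp2).trans h) (hdvd z hz)
    rw [this, h]
    push_cast
    ring

end KleinianInt

theorem sum_divisorsAntidiagonal_prime_mul {f g : ℕ → ℤ} (hf : ∀ m n, f (m * n) = f m * f n)
    (hg : ∀ m n, g (m * n) = g m * g n) {p : ℕ} (hp : p.Prime) {n : ℕ} (hn : n ≠ 0) :
    ∑ x ∈ (p * n).divisorsAntidiagonal, f x.1 * g x.2 +
      f p * g p * (if p ∣ n then ∑ x ∈ (n / p).divisorsAntidiagonal, f x.1 * g x.2 else 0) =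
    (f p + g p) * ∑ x ∈ n.divisorsAntidiagonal, f x.1 * g x.2 := by
  classical
  have hp0 := hp.ne_zero
  set S := (p * n).divisorsAntidiagonal with hS
  have hA : S.filter (p ∣ ·.1) = n.divisorsAntidiagonal.image (fun x => (p * x.1, x.2)) := by
    ext ⟨a, b⟩
    simp only [hS, Finset.mem_filter, Nat.mem_divisorsAntidiagonal, Finset.mem_image, Prod.mk.injEq,
      Prod.exists]
    constructor
    · rintro ⟨⟨h1, h2⟩, c, rfl⟩
      exact ⟨c, b, ⟨mul_left_cancel₀ hp0 (by rw [← h1, mul_assoc]), hn⟩, rfl, rfl⟩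
    · rintro ⟨c, d, ⟨rfl, h⟩, rfl, rfl⟩
      exact ⟨⟨mul_assoc _ _ _, mul_ne_zero hp0 h⟩, dvd_mul_right _ _⟩
  have hB : S.filter (p ∣ ·.2) = n.divisorsAntidiagonal.image (fun x => (x.1, p * x.2)) := by
    ext ⟨a, b⟩
    simp only [hS, Finset.mem_filter, Nat.mem_divisorsAntidiagonal, Finset.mem_image, Prod.mk.injEq,
      Prod.exists]
    constructor
    · rintro ⟨⟨h1, h2⟩, c, rfl⟩
      exact ⟨a, c, ⟨mul_left_cancel₀ hp0 (by rw [← h1, mul_left_comm]), hn⟩, rfl, rfl⟩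
    · rintro ⟨c, d, ⟨rfl, h⟩, rfl, rfl⟩
      exact ⟨⟨mul_left_comm _ _ _, mul_ne_zero hp0 h⟩, dvd_mul_right _ _⟩
  have hU : S.filter (p ∣ ·.1) ∪ S.filter (p ∣ ·.2) = S := by
    rw [← Finset.filter_or, Finset.filter_true_of_mem]
    intro x hx
    rw [hS, Nat.mem_divisorsAntidiagonal] at hx
    exact hp.dvd_mul.1 ⟨n, hx.1⟩
  have hI : ∑ x ∈ S.filter (p ∣ ·.1) ∩ S.filter (p ∣ ·.2), f x.1 * g x.2 =
      f p * g p * (if p ∣ n then ∑ x ∈ (n / p).divisorsAntidiagonal, f x.1 * g x.2 else 0) := by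
    split_ifs with h
    · obtain ⟨m, rfl⟩ := h
      rw [Nat.mul_div_cancel_left _ hp.pos]
      have : S.filter (p ∣ ·.1) ∩ S.filter (p ∣ ·.2) =
          m.divisorsAntidiagonal.image (fun x => (p * x.1, p * x.2)) := by
        ext ⟨a, b⟩
        simp only [hS, Finset.mem_inter, Finset.mem_filter, Nat.mem_divisorsAntidiagonal,
          Finset.mem_image, Prod.mk.injEq, Prod.exists]
        constructor
        · rintro ⟨⟨⟨h1, h2⟩, c, rfl⟩, -, d, rfl⟩
          refine ⟨c, d, ⟨?_, right_ne_zero_of_mul hn⟩, rfl, rfl⟩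
          exact mul_left_cancel₀ hp0 (mul_left_cancel₀ hp0 (by rw [← h1]; ring))
        · rintro ⟨c, d, ⟨rfl, h⟩, rfl, rfl⟩
          have : p * c * (p * d) = p * (p * (c * d)) := by ring
          exact ⟨⟨⟨this, mul_ne_zero hp0 hn⟩, dvd_mul_right _ _⟩,
            ⟨this, mul_ne_zero hp0 hn⟩, dvd_mul_right _ _⟩
      rw [this, Finset.sum_image (fun x _ y _ h => by simpa [hp0, Prod.ext_iff] using h),
        Finset.mul_sum]
      exact Finset.sum_congr rfl fun x _ => by rw [hf, hg]; ring
    · rw [mul_zero]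
      refine Finset.sum_eq_zero fun x hx => (h ?_).elim
      simp only [hS, Finset.mem_inter, Finset.mem_filter, Nat.mem_divisorsAntidiagonal] at hx
      obtain ⟨⟨⟨h1, -⟩, h2⟩, -, h3⟩ := hx
      exact Nat.dvd_of_mul_dvd_mul_left hp.pos (h1 ▸ mul_dvd_mul h2 h3)
  rw [← hI]
  conv_lhs => enter [1, 1]; rw [← hU]
  rw [Finset.sum_union_inter, hA, hB,
    Finset.sum_image (fun x _ y _ h => by simpa [hp0, Prod.ext_iff] using h),
    Finset.sum_image (fun x _ y _ h => by simpa [hp0, Prod.ext_iff] using h), add_mul,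
    Finset.mul_sum, Finset.mul_sum]
  congr 1
  · exact Finset.sum_congr rfl fun x _ => by rw [hf]; ring
  · exact Finset.sum_congr rfl fun x _ => by rw [hg]; ring

/-- The sum of `(d/7)` over the divisors `d` of `n` with odd codivisor. -/
def oddCodivisorSum (n : ℕ) : ℤ :=
  ∑ x ∈ n.divisorsAntidiagonal, legendreSym 7 x.1 * (x.2 % 2 : ℕ)

theorem oddCodivisorSum_prime_mul {p : ℕ} (hp : p.Prime) {n : ℕ} (hn : n ≠ 0) :
    oddCodivisorSum (p * n) + legendreSym 7 p * (p % 2 : ℕ) *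
      (if p ∣ n then oddCodivisorSum (n / p) else 0) =
    (legendreSym 7 p + (p % 2 : ℕ)) * oddCodivisorSum n := by
  refine sum_divisorsAntidiagonal_prime_mul (f := fun n => legendreSym 7 n)
    (g := fun n => ((n % 2 : ℕ) : ℤ)) (fun a b => ?_) (fun a b => ?_) hp hn
  · push_cast; exact legendreSym.mul 7 _ _
  · rcases Nat.mod_two_eq_zero_or_one a with ha | ha <;>
    rcases Nat.mod_two_eq_zero_or_one b with hb | hb <;> simp [Nat.mul_mod, ha, hb]

theorem ncard_oddReps_eq (n : ℕ) (hn : n ≠ 0) :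
    ((KleinianInt.oddReps n).ncard : ℤ) = 2 * oddCodivisorSum n := by
  induction n using Nat.strong_induction_on with
  | _ n ih =>
  rcases eq_or_ne n 1 with rfl | h1
  · have : oddCodivisorSum 1 = 1 := by simp [oddCodivisorSum]
    rw [this, Nat.cast_one, KleinianInt.ncard_oddReps_one]
    norm_num
  obtain ⟨p, hp, m, rfl⟩ := Nat.exists_prime_and_dvd h1
  have hm : m ≠ 0 := right_ne_zero_of_mul hn
  have hlt : m < p * m := by nlinarith [hp.two_le, Nat.pos_of_ne_zero hm]
  have e1 := KleinianInt.ncard_oddReps_prime_mul hp m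
  have e2 := oddCodivisorSum_prime_mul hp hm
  rw [ih m hlt hm] at e1
  have e3 : (if p ∣ m then ((KleinianInt.oddReps ((m / p : ℕ) : ℤ)).ncard : ℤ) else 0) =
      2 * (if p ∣ m then oddCodivisorSum (m / p) else 0) := by
    split_ifs with h
    · exact ih _ ((Nat.div_le_self _ _).trans_lt hlt)
        (Nat.div_pos (Nat.le_of_dvd (Nat.pos_of_ne_zero hm) h) hp.pos).ne'
    · simp
  rw [e3] at e1
  linear_combination e1 - 2 * e2

theorem ncard_oddReps_eq_two_mul_ncard_pos (n : ℤ) :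
    (KleinianInt.oddReps n).ncard = 2 * {z ∈ KleinianInt.oddReps n | 0 < z.re}.ncard := by
  have hfin := KleinianInt.finite_oddReps n
  have hneg : {z ∈ KleinianInt.oddReps n | z.re < 0} =
      Neg.neg '' {z ∈ KleinianInt.oddReps n | 0 < z.re} := by
    ext z
    simp [KleinianInt.oddReps]
  have hU : KleinianInt.oddReps n =
      {z ∈ KleinianInt.oddReps n | 0 < z.re} ∪ {z ∈ KleinianInt.oddReps n | z.re < 0} := by
    rw [← Set.sep_or]
    refine (Set.sep_eq_self_iff_mem_true.2 fun z hz => ?_).symm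
    refine (lt_or_gt_of_ne fun h => ?_)
    have := hz.1
    rw [← h] at this
    exact absurd this (by decide)
  conv_lhs => rw [hU]
  rw [Set.ncard_union_eq ?_ (hfin.subset (Set.sep_subset _ _)) (hfin.subset (Set.sep_subset _ _)),
    hneg, Set.ncard_image_of_injective _ neg_injective, two_mul]
  rw [Set.disjoint_left]
  exact fun z h1 h2 => lt_asymm h1.2 h2.2

/-- The exponent of `q` in the `(m, k)` term of `q * ψ(q) * ψ(q ^ 7)`. -/
def triangularExponent (x : ℕ × ℕ) : ℕ := 1 + x.1 * (x.1 + 1) / 2 + 7 * (x.2 * (x.2 + 1) / 2)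

theorem eight_mul_triangularExponent (x : ℕ × ℕ) :
    8 * triangularExponent x = (2 * x.1 + 1) ^ 2 + 7 * (2 * x.2 + 1) ^ 2 := by
  have h1 := Nat.div_mul_cancel (Nat.even_mul_succ_self x.1).two_dvd
  have h2 := Nat.div_mul_cancel (Nat.even_mul_succ_self x.2).two_dvd
  rw [triangularExponent]
  linarith

theorem ncard_pos_oddReps_eq (n : ℕ) :
    {z ∈ KleinianInt.oddReps n | 0 < z.re}.ncard = (triangularExponent ⁻¹' {n}).ncard := by
  have two_mul_natAbs : ∀ a : ℤ, Odd a → (2 * ((a.natAbs / 2 : ℕ) : ℤ) + 1) = |a| := by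
    rintro a ⟨k, rfl⟩
    rw [Int.abs_eq_natAbs]
    omega
  have odd_add (z : KleinianInt) (h : Odd z.re) : Odd (z.re + 4 * z.im) := by
    obtain ⟨k, hk⟩ := h
    exact ⟨k + 2 * z.im, by linarith⟩
  refine Set.ncard_congr (fun z _ => ((z.re + 4 * z.im).natAbs / 2, z.re.natAbs / 2)) ?_ ?_ ?_
  · rintro z ⟨⟨h1, h2⟩, h3⟩
    rw [KleinianInt.norm_eq] at h2
    have h4 := eight_mul_triangularExponent ((z.re + 4 * z.im).natAbs / 2, z.re.natAbs / 2)
    zify at h4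
    have h5 := two_mul_natAbs _ h1
    have h6 := two_mul_natAbs _ (odd_add z h1)
    push_cast at h5 h6
    rw [h5, h6, sq_abs, sq_abs] at h4
    rw [Set.mem_preimage, Set.mem_singleton_iff]
    zify
    linarith
  · rintro z w ⟨⟨h1, -⟩, h2⟩ ⟨⟨h3, -⟩, h4⟩ h
    simp only [Prod.mk.injEq] at h
    obtain ⟨a, ha⟩ := h1
    obtain ⟨b, hb⟩ := h3
    ext <;> omega
  · rintro ⟨m, k⟩ h
    rw [Set.mem_preimage, Set.mem_singleton_iff] at h
    have h4 := eight_mul_triangularExponent (m, k)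
    rw [h] at h4
    zify at h4
    obtain ⟨t, ht⟩ : ∃ t : ℤ, 2 * m + 1 = 2 * k + 1 + 4 * t ∨ -(2 * m + 1 : ℤ) = 2 * k + 1 + 4 * t := by
      rcases Nat.even_or_odd (m + k) with h | h
      · obtain ⟨r, hr⟩ := h
        exact ⟨r - k, .inl (by omega)⟩
      · obtain ⟨r, hr⟩ := h
        exact ⟨-(r + 1), .inr (by omega)⟩
    have hsq : (2 * k + 1 + 4 * t : ℤ) ^ 2 = (2 * m + 1) ^ 2 := by
      rcases ht with ht | ht <;> rw [← ht]; ring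
    refine ⟨⟨2 * k + 1, t⟩, ⟨⟨⟨k, rfl⟩, ?_⟩, by positivity⟩, ?_⟩
    · rw [KleinianInt.norm_eq]
      simp only
      linarith
    · ext <;> simp only <;> omega

theorem ncard_triangularExponent_fiber (n : ℕ) :
    ((triangularExponent ⁻¹' {n}).ncard : ℤ) = oddCodivisorSum n := by
  rcases eq_or_ne n 0 with rfl | hn
  · have : triangularExponent ⁻¹' {0} = ∅ := by
      ext x
      simp [triangularExponent]
    simp [this, oddCodivisorSum]
  · have h1 := ncard_oddReps_eq n hn
    rw [ncard_oddReps_eq_two_mul_ncard_pos, ncard_pos_oddReps_eq] at h1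
    push_cast at h1
    linarith

theorem norm_legendreSym_le_one (p : ℕ) [Fact p.Prime] (a : ℤ) : ‖(legendreSym p a : ℂ)‖ ≤ 1 := by
  by_cases h : (a : ZMod p) = 0
  · simp [(legendreSym.eq_zero_iff p a).2 h]
  · rcases legendreSym.eq_one_or_neg_one p h with h | h <;> simp [h]

theorem summable_norm_pow_triangular {q : ℂ} (hq : ‖q‖ < 1) :
    Summable fun n : ℕ => ‖q ^ (n * (n + 1) / 2)‖ := by
  refine (summable_geometric_of_lt_one (norm_nonneg q) hq).of_nonneg_of_le
    (fun _ => norm_nonneg _) fun n => ?_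
  rw [norm_pow]
  refine pow_le_pow_of_le_one (norm_nonneg q) hq.le ?_
  rw [Nat.le_div_iff_mul_le two_pos]
  rcases Nat.eq_zero_or_pos n with rfl | h
  · simp
  · exact Nat.mul_le_mul_left _ (by omega)

theorem hasSum_oddCodivisorSum_psi_mul_psi {q : ℂ} (hq : ‖q‖ < 1) :
    HasSum (fun n : ℕ => (oddCodivisorSum n : ℂ) * q ^ n)
      (q * (∑' n : ℕ, q ^ (n * (n + 1) / 2)) * (∑' n : ℕ, (q ^ 7) ^ (n * (n + 1) / 2))) := by
  have hq7 : ‖q ^ 7‖ < 1 := by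
    rw [norm_pow]; exact pow_lt_one₀ (norm_nonneg q) hq (by norm_num)
  have s1 := summable_norm_pow_triangular hq
  have s2 := summable_norm_pow_triangular hq7
  have h := ((summable_mul_of_summable_norm s1 s2).hasSum.mul_left q)
  rw [← tsum_mul_tsum_of_summable_norm s1 s2, ← mul_assoc] at h
  refine (h.tsum_fiberwise triangularExponent).congr_fun fun n => ?_
  have : ∀ x : triangularExponent ⁻¹' {n}, q * (q ^ (x.1.1 * (x.1.1 + 1) / 2) *
      (q ^ 7) ^ (x.1.2 * (x.1.2 + 1) / 2)) = q ^ n := by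
    rintro ⟨x, hx⟩
    have hx' : triangularExponent x = n := hx
    simp only [← hx', triangularExponent, pow_add, pow_one, pow_mul, mul_assoc]
  rw [tsum_congr this, tsum_const, Nat.card_coe_set_eq, nsmul_eq_mul,
    ← ncard_triangularExponent_fiber, Int.cast_natCast]

theorem hasSum_odd_pow {x : ℂ} (hx : ‖x‖ < 1) :
    HasSum (fun k : ℕ => x ^ (2 * k + 1)) (x / (1 - x) - x ^ 2 / (1 - x ^ 2)) := by
  have h1 : 1 - x ≠ 0 := by
    intro h
    rw [← sub_eq_zero.1 h, norm_one] at hx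
    exact lt_irrefl _ hx
  have hx2 : ‖x ^ 2‖ < 1 := by
    rw [norm_pow]; exact pow_lt_one₀ (norm_nonneg x) hx (by norm_num)
  have h2 : 1 - x ^ 2 ≠ 0 := by
    intro h
    rw [← sub_eq_zero.1 h, norm_one] at hx2
    exact lt_irrefl _ hx2
  have h := (hasSum_geometric_of_norm_lt_one hx2).mul_left x
  have e : x / (1 - x) - x ^ 2 / (1 - x ^ 2) = x * (1 - x ^ 2)⁻¹ := by
    field_simp; ring
  rw [e]
  exact h.congr_fun fun k => by rw [pow_succ', pow_mul]

theorem hasSum_oddCodivisorSum_lambert {q : ℂ} (hq : ‖q‖ < 1) :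
    HasSum (fun n : ℕ => (oddCodivisorSum n : ℂ) * q ^ n)
      (∑' j : ℕ, (legendreSym 7 ((j : ℤ) + 1) : ℂ) * (q ^ (1 * (j + 1)) / (1 - q ^ (1 * (j + 1)))
        - q ^ (2 * (j + 1)) / (1 - q ^ (2 * (j + 1))))) := by
  have hr := summable_geometric_of_lt_one (norm_nonneg q) hq
  have hs : Summable fun x : ℕ × ℕ =>
      (legendreSym 7 ((x.1 : ℤ) + 1) : ℂ) * (q ^ (x.1 + 1)) ^ (2 * x.2 + 1) := by
    refine Summable.of_norm_bounded (hr.mul_of_nonneg hr (fun _ => by positivity)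
      (fun _ => by positivity)) fun x => ?_
    rw [norm_mul, ← pow_mul, norm_pow, ← pow_add]
    refine (mul_le_of_le_one_left (by positivity) (norm_legendreSym_le_one _ _)).trans ?_
    exact pow_le_pow_of_le_one (norm_nonneg q) hq.le (by nlinarith [Nat.zero_le (x.1 * x.2)])
  have h := hs.hasSum
  rw [hs.tsum_prod] at h
  have e : ∀ j : ℕ, ∑' k : ℕ, (legendreSym 7 ((j : ℤ) + 1) : ℂ) * (q ^ (j + 1)) ^ (2 * k + 1) =
      (legendreSym 7 ((j : ℤ) + 1) : ℂ) * (q ^ (1 * (j + 1)) / (1 - q ^ (1 * (j + 1)))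
        - q ^ (2 * (j + 1)) / (1 - q ^ (2 * (j + 1)))) := fun j => by
    have hj : ‖q ^ (j + 1)‖ < 1 := by
      rw [norm_pow]; exact pow_lt_one₀ (norm_nonneg q) hq (by omega)
    rw [tsum_mul_left, (hasSum_odd_pow hj).tsum_eq, one_mul, mul_comm 2 (j + 1), pow_mul]
  rw [tsum_congr e] at h
  let G : ℕ × ℕ → ℂ := fun x => ((legendreSym 7 x.1 * (x.2 % 2 : ℕ) : ℤ) : ℂ) * q ^ (x.1 * x.2)
  have hinj : Function.Injective fun x : ℕ × ℕ => (x.1 + 1, 2 * x.2 + 1) := fun x y hxy => by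
    simp only [Prod.mk.injEq] at hxy
    ext <;> omega
  have hG : ∀ x ∉ Set.range fun x : ℕ × ℕ => (x.1 + 1, 2 * x.2 + 1), G x = 0 := by
    rintro ⟨a, b⟩ hx
    rcases Nat.eq_zero_or_pos a with rfl | ha
    · simp [G]
    rcases Nat.mod_two_eq_zero_or_one b with hb | hb
    · simp only [G, hb, Nat.cast_zero, mul_zero, Int.cast_zero, zero_mul]
    · exact (hx ⟨(a - 1, b / 2), by ext <;> simp only <;> omega⟩).elim
  have hsum := (hinj.hasSum_iff hG).1 (h.congr_fun fun x => by
    simp [G, pow_mul])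
  refine (hsum.tsum_fiberwise fun x => x.1 * x.2).congr_fun fun n => ?_
  rcases eq_or_ne n 0 with rfl | hn
  · have : ∀ x : (fun x : ℕ × ℕ => x.1 * x.2) ⁻¹' {0}, G x = 0 := by
      rintro ⟨⟨a, b⟩, hx⟩
      rcases Nat.mul_eq_zero.1 (show a * b = 0 from hx) with rfl | rfl <;> simp [G]
    rw [tsum_congr this]
    simp [oddCodivisorSum]
  · have : (fun x : ℕ × ℕ => x.1 * x.2) ⁻¹' {n} = (n.divisorsAntidiagonal : Set (ℕ × ℕ)) := by
      ext x
      simp [hn]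
    rw [this, Finset.tsum_subtype', oddCodivisorSum, Int.cast_sum, Finset.sum_mul]
    refine Finset.sum_congr rfl fun x hx => ?_
    rw [← (Nat.mem_divisorsAntidiagonal.1 hx).1]

theorem statement3 (q : ℂ) (hq : ‖q‖ < 1) :
    q * (∑' n : ℕ, (q) ^ (n * (n + 1) / 2)) * (∑' n : ℕ, (q ^ 7) ^ (n * (n + 1) / 2)) =
      ∑' j : ℕ, (legendreSym 7 ((j : ℤ) + 1) : ℂ) * (q ^ (1 * (j + 1)) / (1 - q ^ (1 * (j + 1))) - q ^ (2 * (j + 1)) / (1 - q ^ (2 * (j + 1)))) := by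
  exact (hasSum_oddCodivisorSum_psi_mul_psi hq).unique (hasSum_oddCodivisorSum_lambert hq)
end
end
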